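/- Let Y be a Poisson random variable with rate γ > 0, let μ > 0 and t ≥ 0 be real numbers, and set s := ⌊γt/μ⌋. Then the scaled Poisson demand D := (μ/γ)·Y satisfies E[(t − D)⁺] = (t − μ)·F_γ(s) + μ·P_γ(s), where P_γ(k) = e^{−γ}γ^k/k! is the Poisson PMF and F_γ(s) = Σ_{k=0}^s P_γ(k) is the Poisson CDF. -/

import Mathlib

open MeasureTheory

/-- The Poisson PMF `P_γ(k) = e^{−γ} γ^k / k!`. -/
noncomputable def poissonPMF (γ : ℝ) (k : ℕ) : ℝ :=
  Real.exp (-γ) * γ ^ k / (Nat.factorial k)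

/-- The Poisson CDF `F_γ(s) = Σ_{k=0}^s P_γ(k)`. -/
noncomputable def poissonCDF (γ : ℝ) (s : ℕ) : ℝ :=
  ∑ k ∈ Finset.range (s + 1), poissonPMF γ k

open ProbabilityTheory in
/-- A natural-number-valued random variable with point masses `poissonPMF γ` has the Poisson law. -/
theorem map_eq_poissonMeasure {Ω : Type*} [MeasurableSpace Ω] {P : Measure Ω} {Y : Ω → ℕ}
    (hYmeas : Measurable Y) {γ : ℝ} (hγ : 0 ≤ γ)
    (hY : ∀ k : ℕ, P {ω | Y ω = k} = ENNReal.ofReal (poissonPMF γ k)) :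
    P.map Y = poissonMeasure γ.toNNReal := by
  refine Measure.ext_of_singleton fun k => ?_
  rw [Measure.map_apply hYmeas (measurableSet_singleton k), poissonMeasure_singleton,
    Real.coe_toNNReal γ hγ]
  exact hY k

/-- The partial first moment of the Poisson distribution. -/
theorem sum_range_succ_mul_poissonPMF (γ : ℝ) (s : ℕ) :
    ∑ k ∈ Finset.range (s + 1), (k : ℝ) * poissonPMF γ k
      = γ * (poissonCDF γ s - poissonPMF γ s) := by
  have hsucc (k : ℕ) : ((k + 1 : ℕ) : ℝ) * poissonPMF γ (k + 1) = γ * poissonPMF γ k := by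
    unfold poissonPMF
    rw [Nat.factorial_succ, pow_succ]
    push_cast
    field_simp
  rw [Finset.sum_range_succ', poissonCDF, Finset.sum_range_succ, add_sub_cancel_right,
    Finset.mul_sum]
  simp only [hsucc, Nat.cast_zero, zero_mul, add_zero]

/-- **Expected wastage lower bound (Proposition 2).** For a scaled Poisson demand
`D = (μ/γ)·Y` with `Y ~ Poisson(γ)` and `t ≥ 0`, with `s = ⌊γt/μ⌋`,
`E[(t − D)⁺] = (t − μ)·F_γ(s) + μ·P_γ(s)`. -/
theorem expected_wastage_scaled_poisson
    {Ω : Type*} [MeasurableSpace Ω] (μm : Measure Ω) [IsProbabilityMeasure μm]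
    (Y : Ω → ℕ) (hYmeas : Measurable Y) (γ μ t : ℝ) (hγ : 0 < γ) (hμ : 0 < μ) (ht : 0 ≤ t)
    (hY : ∀ k : ℕ, μm {ω | Y ω = k} = ENNReal.ofReal (poissonPMF γ k))
    (s : ℕ) (hs : s = ⌊γ * t / μ⌋₊) :
    ∫ ω, max (t - (μ / γ) * (Y ω : ℝ)) 0 ∂μm
      = (t - μ) * poissonCDF γ s + μ * poissonPMF γ s := by
  have hint : ∫ ω, max (t - (μ / γ) * (Y ω : ℝ)) 0 ∂μm
      = ∑' k : ℕ, poissonPMF γ k * max (t - (μ / γ) * (k : ℝ)) 0 := by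
    rw [← integral_map (f := fun k : ℕ => max (t - (μ / γ) * (k : ℝ)) 0)
        hYmeas.aemeasurable .of_discrete,
      map_eq_poissonMeasure hYmeas hγ.le hY, ProbabilityTheory.integral_poissonMeasure,
      Real.coe_toNNReal γ hγ.le]
    rfl
  have hle (k : ℕ) : k ≤ s ↔ μ / γ * (k : ℝ) ≤ t := by
    rw [hs, Nat.le_floor_iff (by positivity), le_div_iff₀ hμ, div_mul_eq_mul_div,
      div_le_iff₀ hγ, mul_comm (k : ℝ), mul_comm γ]
  rw [hint, tsum_eq_sum (s := Finset.range (s + 1))]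
  · calc
      _ = ∑ k ∈ Finset.range (s + 1),
            (t * poissonPMF γ k - μ / γ * ((k : ℝ) * poissonPMF γ k)) := by
        refine Finset.sum_congr rfl fun k hk => ?_
        have := (hle k).1 (Finset.mem_range_succ_iff.1 hk)
        rw [max_eq_left (sub_nonneg.2 this)]
        ring
      _ = t * poissonCDF γ s - μ / γ * (γ * (poissonCDF γ s - poissonPMF γ s)) := by
        rw [Finset.sum_sub_distrib, ← Finset.mul_sum, ← Finset.mul_sum,
          sum_range_succ_mul_poissonPMF, poissonCDF]
      _ = _ := by
        field_simp
        ring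
  · intro k hk
    have := mt (hle k).2 (mt Finset.mem_range_succ_iff.2 hk)
    rw [max_eq_right (sub_nonpos.2 (not_le.1 this).le), mul_zero]
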